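/- Let V_g : ℝ³ \ {0} → ℝ be the Newtonian potential V_g(χ) = −kM/‖χ‖ with constants k, M > 0, and let Y : [0,∞) → ℝ³ \ {0} be continuous. If every third partial derivative of V_g evaluated along Y is constant in time, i.e. for all indices i, j, k the function t ↦ (∂³V_g/∂χⁱ∂χʲ∂χᵏ)(Y(t)) is constant on [0,∞), then Y itself is constant: Y(t) = Y(0) for all t ≥ 0. -/

import Mathlib

/-- The Newtonian potential `V_g(χ) = -kM/‖χ‖` generated by a pointlike mass `M`. -/
noncomputable def newtonPotential (k M : ℝ) : EuclideanSpace ℝ (Fin 3) → ℝ :=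
  fun χ => -(k * M) / ‖χ‖

/-- The partial derivative `∂f/∂χⁱ` of a scalar function on `ℝ³`. -/
noncomputable def partialD (i : Fin 3) (f : EuclideanSpace ℝ (Fin 3) → ℝ) :
    EuclideanSpace ℝ (Fin 3) → ℝ :=
  fun x => fderiv ℝ f x (EuclideanSpace.single i 1)

abbrev E3 := EuclideanSpace ℝ (Fin 3)

lemma partialD_congr (i : Fin 3) {f g : E3 → ℝ} (h : ∀ x, x ≠ 0 → f x = g x) (x : E3) (hx : x ≠ 0) :
    partialD i f x = partialD i g x := by
  unfold partialD
  have : f =ᶠ[nhds x] g := by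
    filter_upwards [isOpen_ne.mem_nhds hx] with y hy using h y hy
  rw [this.fderiv_eq]

lemma hasFDerivAt_nrm (x : E3) (hx : x ≠ 0) :
    HasFDerivAt (fun y : E3 => ‖y‖) (‖x‖⁻¹ • innerSL ℝ x) x := by
  have h1 : HasFDerivAt (fun y : E3 => ‖y‖ ^ 2) (2 • innerSL ℝ x) x :=
    (hasStrictFDerivAt_norm_sq x).hasFDerivAt
  have hp : 0 < ‖x‖ := norm_pos_iff.2 hx
  have h2 := h1.sqrt (by positivity)
  have h3 : (fun y : E3 => √(‖y‖ ^ 2)) = fun y => ‖y‖ := by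
    funext y; exact Real.sqrt_sq (norm_nonneg y)
  rw [h3, Real.sqrt_sq hp.le] at h2
  refine h2.congr_fderiv ?_
  ext v
  simp only [smul_apply, smul_eq_mul, nsmul_eq_mul, Nat.cast_ofNat]
  field_simp

lemma hasFDerivAt_invpow (n : ℕ) (x : E3) (hx : x ≠ 0) :
    HasFDerivAt (fun y : E3 => (‖y‖ ^ (n + 1))⁻¹)
      ((-((n + 1 : ℕ) : ℝ) * (‖x‖ ^ (n + 3))⁻¹) • innerSL ℝ x) x := by
  have hp : 0 < ‖x‖ := norm_pos_iff.2 hx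
  have h := ((hasDerivAt_pow (n + 1) ‖x‖).inv (by positivity)).comp_hasFDerivAt x
    (hasFDerivAt_nrm x hx)
  refine h.congr_fderiv ?_
  symm
  rw [smul_smul]
  congr 1
  simp only [Nat.add_sub_cancel]
  field_simp
  ring

lemma hasFDerivAt_coord (i : Fin 3) (x : E3) :
    HasFDerivAt (fun y : E3 => y i) (EuclideanSpace.proj i : E3 →L[ℝ] ℝ) x :=
  (EuclideanSpace.proj i : E3 →L[ℝ] ℝ).hasFDerivAt

def dl (i j : Fin 3) : ℝ := if i = j then 1 else 0

lemma inner_sgl (x : E3) (i : Fin 3) : inner ℝ x (EuclideanSpace.single i (1:ℝ)) = x i := by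
  rw [EuclideanSpace.inner_single_right]; simp

lemma sgl_apply (i l : Fin 3) :
    (EuclideanSpace.proj l : E3 →L[ℝ] ℝ) (EuclideanSpace.single i (1:ℝ)) = dl l i := by
  simp [dl]

lemma pd1 (c : ℝ) (k M : ℝ) (hc : c = k * M) (l : Fin 3) (x : E3) (hx : x ≠ 0) :
    partialD l (newtonPotential k M) x = c * (x l * (‖x‖ ^ 3)⁻¹) := by
  have h := (hasFDerivAt_invpow 0 x hx).const_mul (-c)
  have e : newtonPotential k M = fun y => -c * (‖y‖ ^ (0 + 1))⁻¹ := by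
    funext y; simp [newtonPotential, hc, div_eq_mul_inv]
  rw [e]
  unfold partialD
  rw [h.fderiv]
  simp only [smul_apply, sub_apply, add_apply, smul_eq_mul,
    innerSL_apply_apply, inner_sgl, sgl_apply, Pi.mul_apply]
  push_cast
  ring

lemma pd2 (c : ℝ) (k M : ℝ) (hc : c = k * M) (j l : Fin 3) (x : E3) (hx : x ≠ 0) :
    partialD j (partialD l (newtonPotential k M)) x =
      c * (dl l j * (‖x‖ ^ 3)⁻¹ - 3 * (x j * x l * (‖x‖ ^ 5)⁻¹)) := by
  rw [partialD_congr j (pd1 c k M hc l) x hx]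
  have h := ((hasFDerivAt_coord l x).mul (hasFDerivAt_invpow 2 x hx)).const_mul c
  unfold partialD
  erw [h.fderiv]
  simp only [smul_apply, sub_apply, add_apply, smul_eq_mul,
    innerSL_apply_apply, inner_sgl, sgl_apply, Pi.mul_apply]
  push_cast
  ring

lemma pd3 (c : ℝ) (k M : ℝ) (hc : c = k * M) (i j l : Fin 3) (x : E3) (hx : x ≠ 0) :
    partialD i (partialD j (partialD l (newtonPotential k M))) x =
      c * (-3 * (dl l j * x i + dl j i * x l + dl l i * x j) * (‖x‖ ^ 5)⁻¹
        + 15 * (x i * x j * x l * (‖x‖ ^ 7)⁻¹)) := by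
  rw [partialD_congr i (pd2 c k M hc j l) x hx]
  have h := ((hasFDerivAt_invpow 2 x hx).const_mul (dl l j)).sub
    ((((hasFDerivAt_coord j x).mul (hasFDerivAt_coord l x)).mul
      (hasFDerivAt_invpow 4 x hx)).const_mul 3) |>.const_mul c
  unfold partialD
  erw [h.fderiv]
  simp only [smul_apply, sub_apply, add_apply, smul_eq_mul,
    innerSL_apply_apply, inner_sgl, sgl_apply, Pi.mul_apply]
  push_cast
  ring

lemma contr (c : ℝ) (k M : ℝ) (hc : c = k * M) (x y : E3) (hx : x ≠ 0) :
    ∑ i, ∑ j, ∑ l, y i * y j * y l *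
      partialD i (partialD j (partialD l (newtonPotential k M))) x =
    c * (15 * (inner ℝ x y) ^ 3 - 9 * ‖x‖ ^ 2 * ‖y‖ ^ 2 * inner ℝ x y) * (‖x‖ ^ 7)⁻¹ := by
  have hp : 0 < ‖x‖ := norm_pos_iff.2 hx
  have h5 : (‖x‖ ^ 5)⁻¹ = ‖x‖ ^ 2 * (‖x‖ ^ 7)⁻¹ := by field_simp
  have hy : ‖y‖ ^ 2 = y 0 ^ 2 + y 1 ^ 2 + y 2 ^ 2 := by
    simp [EuclideanSpace.norm_sq_eq, Fin.sum_univ_three]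
  have hi : inner ℝ x y = x 0 * y 0 + x 1 * y 1 + x 2 * y 2 := by
    simp [PiLp.inner_apply, Fin.sum_univ_three]; ring
  simp only [pd3 c k M hc _ _ _ x hx, h5, hy, hi]
  generalize (‖x‖ ^ 7)⁻¹ = u
  generalize ‖x‖ ^ 2 = v
  simp [Fin.sum_univ_three, dl]
  ring

lemma inj_aux (x y : E3) (hx : x ≠ 0) (hy : y ≠ 0) (c k M : ℝ) (hc : c = k * M) (h0 : 0 < c)
    (h : ∀ i j l, partialD i (partialD j (partialD l (newtonPotential k M))) x =
      partialD i (partialD j (partialD l (newtonPotential k M))) y) : x = y := by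
  have hX := contr c k M hc x x hx
  have hY := contr c k M hc y y hy
  have hXY := contr c k M hc x y hx
  have hYX := contr c k M hc y x hy
  simp only [h] at hX hXY
  rw [hX] at hYX
  rw [hY] at hXY
  rw [real_inner_self_eq_norm_sq] at hYX hXY
  rw [real_inner_comm] at hYX
  have ha : 0 < ‖x‖ := norm_pos_iff.2 hx
  have hb : 0 < ‖y‖ := norm_pos_iff.2 hy
  obtain ⟨s, hs⟩ : ∃ s, inner ℝ x y = s * (‖x‖ * ‖y‖) :=
    ⟨inner ℝ x y / (‖x‖ * ‖y‖), by field_simp⟩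
  rw [hs] at hYX hXY
  have hn := norm_sub_sq_real x y
  rw [hs] at hn
  generalize ‖x‖ = a at *
  generalize ‖y‖ = b at *
  have e1 : 6 * b ^ 4 = (15 * s ^ 3 - 9 * s) * a ^ 4 := by
    field_simp at hYX
    nlinarith [hYX]
  have e2 : 6 * a ^ 4 = (15 * s ^ 3 - 9 * s) * b ^ 4 := by
    field_simp at hXY
    nlinarith [hXY]
  have hab : a ^ 4 = b ^ 4 := by
    have q : 0 < 15 * s ^ 3 - 9 * s := by
      by_contra hq
      have : 0 < a ^ 4 := by positivity
      have : 0 < b ^ 4 := by positivity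
      nlinarith
    have : (6 + (15 * s ^ 3 - 9 * s)) * (a ^ 4 - b ^ 4) = 0 := by linarith
    rcases mul_eq_zero.1 this with h | h <;> linarith
  have hab' : a = b := (pow_left_inj₀ ha.le hb.le (by norm_num)).1 hab
  subst hab'
  have hs1 : s = 1 := by
    have h4 : a ^ 4 ≠ 0 := by positivity
    have : (s - 1) * (15 * s ^ 2 + 15 * s + 6) = 0 := by
      apply mul_right_cancel₀ h4
      linarith
    rcases mul_eq_zero.1 this with h | h
    · linarith
    · nlinarith [sq_nonneg (2 * s + 1)]
  subst hs1
  have : ‖x - y‖ ^ 2 = 0 := by rw [hn]; ring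
  exact sub_eq_zero.1 (norm_eq_zero.1 (pow_eq_zero_iff (by norm_num) |>.1 this))

/-- If `Y : [0,∞) → ℝ³ \ {0}` is continuous and every third partial derivative of the
Newtonian potential `V_g` is constant in time along `Y`, then `Y` is constant. -/
theorem newtonPotential_third_partials_const_imp_const
    (k M : ℝ) (hk : 0 < k) (hM : 0 < M)
    (Y : ℝ → EuclideanSpace ℝ (Fin 3))
    (hcont : ContinuousOn Y (Set.Ici (0:ℝ)))
    (hne : ∀ t : ℝ, 0 ≤ t → Y t ≠ 0)
    (hconst : ∀ i j l : Fin 3, ∀ t : ℝ, 0 ≤ t →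
      partialD i (partialD j (partialD l (newtonPotential k M))) (Y t) =
      partialD i (partialD j (partialD l (newtonPotential k M))) (Y 0)) :
    ∀ t : ℝ, 0 ≤ t → Y t = Y 0 := by
  intro t ht
  exact inj_aux _ _ (hne t ht) (hne 0 le_rfl) (k * M) k M rfl (mul_pos hk hM)
    (fun i j l => hconst i j l t ht)
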